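/- Fix vectors u, v ∈ ℝ^m and let α₁,…,α_q be i.i.d. random vectors with distribution N(0, τ²·I_m). Let σ' : ℝ → ℝ be a measurable function satisfying σ'(r)² + σ'(−r)² ≥ 2c² for all r ∈ ℝ, for a constant c > 0. Then, with probability at least 1 − e^{−0.005·q}, one has ∑_{i=1}^q σ'(α_iᵀu)²·(α_iᵀv)² ≥ 0.1·q·c²·τ²·‖v‖². -/

import Mathlib

open MeasureTheory ProbabilityTheory Real

/-- Currying identifies a product of identical measures indexed by `ι × κ` with an iterated
product. -/
lemma map_uncurry_pi_pi {ι κ X : Type*} [Fintype ι] [Fintype κ] [MeasurableSpace X]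
    (μ : Measure X) [SigmaFinite μ] :
    (Measure.pi fun _ : ι => Measure.pi fun _ : κ => μ).map Function.uncurry
      = Measure.pi fun _ : ι × κ => μ := by
  refine (Measure.pi_eq fun s hs => ?_).symm
  rw [Measure.map_apply measurable_uncurry (MeasurableSet.univ_pi hs)]
  have h : (Function.uncurry ⁻¹' Set.univ.pi s : Set (ι → κ → X))
      = Set.univ.pi fun i => Set.univ.pi fun j => s (i, j) := by
    ext x
    simp [Set.mem_pi]
  rw [h, Measure.pi_pi]
  simp_rw [Measure.pi_pi]
  rw [Fintype.prod_prod_type]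

/-- A linear form of a vector of i.i.d. centered Gaussians is a centered Gaussian. -/
lemma map_sum_mul_pi_gaussianReal {ι : Type*} [Fintype ι] (w : NNReal)
    (v : EuclideanSpace ℝ ι) :
    (Measure.pi fun _ : ι => gaussianReal 0 w).map (fun a => ∑ j, a j * v j)
      = gaussianReal 0 (w * ‖v‖₊ ^ 2) := by
  have hm : Measurable fun a : ι → ℝ => ∑ j, a j * v j := by fun_prop
  have := Measure.isProbabilityMeasure_map (μ := Measure.pi fun _ : ι => gaussianReal 0 w)
    hm.aemeasurable
  refine Measure.ext_of_charFun (funext fun t => ?_)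
  rw [charFun_apply_real, integral_map hm.aemeasurable (by fun_prop)]
  have h : ∀ a : ι → ℝ, Complex.exp (t * ((∑ j, a j * v j : ℝ) : ℂ) * Complex.I)
      = ∏ j, Complex.exp ((t * v j : ℝ) * (a j : ℂ) * Complex.I) := fun a => by
    rw [← Complex.exp_sum]
    push_cast
    rw [Finset.mul_sum, Finset.sum_mul]
    exact congrArg _ (Finset.sum_congr rfl fun j _ => by ring)
  simp_rw [h]
  rw [integral_fintype_prod_eq_prod
    (fun j (x : ℝ) => Complex.exp ((t * v j : ℝ) * (x : ℂ) * Complex.I))]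
  simp_rw [← charFun_apply_real, charFun_gaussianReal]
  rw [← Complex.exp_sum]
  congr 1
  have hv : ((‖v‖ : ℝ) : ℂ) ^ 2 = ∑ j, (v j : ℂ) ^ 2 := by
    rw [← Complex.ofReal_pow, EuclideanSpace.real_norm_sq_eq]
    push_cast
    rfl
  push_cast
  rw [hv]
  simp only [mul_zero, zero_mul, zero_sub, Finset.sum_neg_distrib, Finset.mul_sum, Finset.sum_mul,
    Finset.sum_div]
  exact congrArg _ (Finset.sum_congr rfl fun j _ => by ring)

/-- The Laplace transform of the square of a centered Gaussian variable. -/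
lemma integral_exp_neg_mul_sq_gaussianReal {w : NNReal} (hw : w ≠ 0) {s : ℝ} (hs : 0 ≤ s) :
    ∫ x, exp (-(s * x ^ 2)) ∂gaussianReal 0 w = (√(1 + 2 * s * w))⁻¹ := by
  have hw' : (0 : ℝ) < w := by positivity
  rw [integral_gaussianReal_eq_integral_smul hw]
  have h : ∀ x : ℝ, gaussianPDFReal 0 w x • exp (-(s * x ^ 2))
      = (√(2 * π * w))⁻¹ * exp (-((1 + 2 * s * w) / (2 * w)) * x ^ 2) := fun x => by
    rw [gaussianPDFReal_def, smul_eq_mul, mul_assoc, ← exp_add]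
    congr 2
    field_simp
    ring
  simp_rw [h]
  rw [integral_const_mul, integral_gaussian, ← sqrt_inv, ← sqrt_inv,
    ← sqrt_mul (by positivity)]
  congr 1
  field_simp

/-- The product of i.i.d. centered Gaussians is invariant under `a ↦ -a`. -/
lemma measurePreserving_neg_pi_gaussianReal {ι : Type*} [Fintype ι] (w : NNReal) :
    MeasurePreserving (fun a : ι → ℝ => -a) (Measure.pi fun _ : ι => gaussianReal 0 w)
      (Measure.pi fun _ : ι => gaussianReal 0 w) :=
  measurePreserving_pi _ _ fun _ =>
    ⟨measurable_neg, gaussianReal_map_neg.trans (by rw [neg_zero])⟩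

/-- Chernoff bound for the lower tail of a sum of i.i.d. nonnegative variables whose Laplace
transform at `1` is at most `2 / 3`. -/
lemma pi_sum_lt_le_exp {X : Type*} [MeasurableSpace X] (ν : Measure X) [IsProbabilityMeasure ν]
    {f : X → ℝ} (hf : Measurable f) (hf0 : ∀ x, 0 ≤ f x)
    (hE : ∫ x, exp (-f x) ∂ν ≤ 2 / 3) (q : ℕ) :
    (Measure.pi fun _ : Fin q => ν).real {x | ∑ i, f (x i) < 0.2 * q}
      ≤ exp (-0.005 * q) := by
  set μ := Measure.pi fun _ : Fin q => ν
  have hint : Integrable (fun x : Fin q → X => ∏ i, exp (-f (x i))) μ := by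
    refine Integrable.of_bound (C := 1) (Measurable.aestronglyMeasurable (by fun_prop))
      (ae_of_all _ fun x => ?_)
    rw [norm_of_nonneg (by positivity)]
    exact Finset.prod_le_one (fun _ _ => by positivity)
      fun i _ => exp_le_one_iff.2 (neg_nonpos.2 (hf0 _))
  have hmarkov := mul_meas_ge_le_integral_of_nonneg
    (ae_of_all _ fun x => by positivity) hint (exp (-(0.2 * q)))
  rw [integral_fintype_prod_eq_pow (fun x => exp (-f x)), Fintype.card_fin] at hmarkov
  have hsub : μ.real {x | ∑ i, f (x i) < 0.2 * q}
      ≤ μ.real {x | exp (-(0.2 * q)) ≤ ∏ i, exp (-f (x i))} := by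
    refine measureReal_mono fun x hx => ?_
    simp only [Set.mem_ofPred_eq] at hx ⊢
    rw [← exp_sum, Finset.sum_neg_distrib]
    exact exp_le_exp.2 (by linarith)
  have hE0 : 0 ≤ ∫ x, exp (-f x) ∂ν := integral_nonneg fun x => (exp_pos _).le
  have hexp : (2 / 3 : ℝ) ≤ exp (-0.205) := by
    have h := exp_bound' (x := 0.205) (by norm_num) (by norm_num) (n := 3) (by norm_num)
    norm_num [Finset.sum_range_succ, Nat.factorial] at h
    rw [exp_neg, le_inv_comm₀ (by norm_num) (exp_pos _)]
    norm_num
    linarith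
  have hpow : (∫ x, exp (-f x) ∂ν) ^ q ≤ exp (-(0.2 * q)) * exp (-0.005 * q) := by
    calc (∫ x, exp (-f x) ∂ν) ^ q ≤ exp (-0.205) ^ q := by gcongr; exact hE.trans hexp
      _ = exp (-(0.2 * q)) * exp (-0.005 * q) := by
        rw [← exp_nat_mul, ← exp_add]
        congr 1
        ring
  exact hsub.trans (le_of_mul_le_mul_left (hmarkov.trans hpow) (exp_pos _))

/-- Symmetrization: the Laplace transform of `σ(aᵀu)² (aᵀv)²` for a Gaussian vector `a` is at most
`2 / 3` at the scale `2 / (c² w ‖v‖²)`. -/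
lemma integral_exp_neg_sq_mul_sq_le {ι : Type*} [Fintype ι] {w : NNReal} (hw : w ≠ 0)
    (u v : EuclideanSpace ℝ ι) (hv : v ≠ 0) {σ : ℝ → ℝ} (hσm : Measurable σ) {c : ℝ}
    (hc : 0 < c) (hσ : ∀ r : ℝ, 2 * c ^ 2 ≤ σ r ^ 2 + σ (-r) ^ 2) :
    ∫ a, exp (-(2 / (c ^ 2 * w * ‖v‖ ^ 2) *
        (σ (∑ j, a j * u j) ^ 2 * (∑ j, a j * v j) ^ 2)))
      ∂(Measure.pi fun _ : ι => gaussianReal 0 w) ≤ 2 / 3 := by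
  have hw' : (0 : ℝ) < w := by positivity
  have hv' : 0 < ‖v‖ := norm_pos_iff.2 hv
  set ν := Measure.pi fun _ : ι => gaussianReal 0 w
  set l := 2 / (c ^ 2 * w * ‖v‖ ^ 2) with hl
  have hl0 : 0 < l := by positivity
  set F : (ι → ℝ) → ℝ := fun a =>
    exp (-(l * (σ (∑ j, a j * u j) ^ 2 * (∑ j, a j * v j) ^ 2))) with hF
  set G : ℝ → ℝ := fun z => exp (-(2 * l * c ^ 2 * z ^ 2)) with hG
  have hFm : Measurable F := by fun_prop
  have hF1 : ∀ a, F a ≤ 1 := fun a => exp_le_one_iff.2 (neg_nonpos.2 (by positivity))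
  have hFint : Integrable F ν := Integrable.of_bound (C := 1) hFm.aestronglyMeasurable
    (ae_of_all _ fun a => by rw [norm_of_nonneg (exp_pos _).le]; exact hF1 a)
  have hsum : Measurable fun a : ι → ℝ => ∑ j, a j * v j := by fun_prop
  have hGint : Integrable (fun a : ι → ℝ => G (∑ j, a j * v j)) ν :=
    Integrable.of_bound (C := 1) (Measurable.aestronglyMeasurable (by fun_prop))
      (ae_of_all _ fun a => by
        rw [norm_of_nonneg (exp_pos _).le]
        exact exp_le_one_iff.2 (neg_nonpos.2 (by positivity)))
  have hneg := measurePreserving_neg_pi_gaussianReal (ι := ι) w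
  have hFneg : ∫ a, F (-a) ∂ν = ∫ a, F a ∂ν :=
    hneg.integral_comp (MeasurableEquiv.neg (ι → ℝ)).measurableEmbedding F
  have hFnegint : Integrable (fun a => F (-a)) ν := hneg.integrable_comp_of_integrable hFint
  have hpair : ∀ a, F a + F (-a) ≤ 1 + G (∑ j, a j * v j) := fun a => by
    have hmul : F a * F (-a) ≤ G (∑ j, a j * v j) := by
      simp only [hF, hG, Pi.neg_apply, neg_mul, Finset.sum_neg_distrib, ← exp_add, neg_sq]
      refine exp_le_exp.2 ?_
      have := mul_le_mul_of_nonneg_left (hσ (∑ j, a j * u j))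
        (by positivity : 0 ≤ l * (∑ j, a j * v j) ^ 2)
      linarith
    nlinarith [mul_nonneg (sub_nonneg.2 (hF1 a)) (sub_nonneg.2 (hF1 (-a)))]
  have hGval : ∫ a, G (∑ j, a j * v j) ∂ν = 1 / 3 := by
    rw [← integral_map (f := G) hsum.aemeasurable (by fun_prop), map_sum_mul_pi_gaussianReal,
      integral_exp_neg_mul_sq_gaussianReal (mul_ne_zero hw (by simpa using hv)) (by positivity)]
    have h9 : 1 + 2 * (2 * l * c ^ 2) * ((w * ‖v‖₊ ^ 2 : NNReal) : ℝ) = 3 ^ 2 := by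
      push_cast
      rw [hl]
      field_simp
      norm_num
    rw [h9, sqrt_sq (by norm_num), one_div]
  have := integral_mono (hFint.add hFnegint) ((integrable_const 1).add hGint) hpair
  simp only [Pi.add_apply] at this
  rw [integral_add hFint hFnegint, integral_add (integrable_const 1) hGint, hFneg, hGval] at this
  simp only [integral_const, probReal_univ, smul_eq_mul] at this
  linarith



/-- **Key lemma (Lemma 5.1).** Fix `u, v ∈ ℝ^m` and let `α₁,…,α_q` be i.i.d. `N(0, τ²·I_m)`.
Let `σ' : ℝ → ℝ` be measurable with `σ'(r)² + σ'(−r)² ≥ 2c²` for all `r` (for a constant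
`c > 0`). Then with probability at least `1 − e^{−0.005·q}`,
`∑_{i=1}^q σ'(αᵢᵀu)²·(αᵢᵀv)² ≥ 0.1·q·c²·τ²·‖v‖²`. -/
theorem gaussian_rows_high_prob
    {Ω : Type*} [MeasurableSpace Ω] (P : Measure Ω) [IsProbabilityMeasure P]
    (m q : ℕ) (u v : EuclideanSpace ℝ (Fin m)) (τ : NNReal)
    (α : Ω → Fin q → Fin m → ℝ)
    (hα : Measure.map (fun ω => fun p : Fin q × Fin m => α ω p.1 p.2) P
        = Measure.pi fun _ : Fin q × Fin m => gaussianReal 0 (τ ^ 2))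
    (σ' : ℝ → ℝ) (hσ'meas : Measurable σ') (c : ℝ) (hc : 0 < c)
    (hσ' : ∀ r : ℝ, 2 * c ^ 2 ≤ σ' r ^ 2 + σ' (-r) ^ 2) :
    ENNReal.ofReal (1 - Real.exp (-0.005 * q)) ≤
      P {ω | 0.1 * q * c ^ 2 * (τ : ℝ) ^ 2 * ‖v‖ ^ 2 ≤
        ∑ i, σ' (∑ j, α ω i j * u j) ^ 2 * (∑ j, α ω i j * v j) ^ 2} := by
  set w : NNReal := τ ^ 2 with hw_def
  by_cases hK : w = 0 ∨ v = 0
  · have hz : (τ : ℝ) ^ 2 * ‖v‖ ^ 2 = 0 := by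
      rcases hK with h | h
      · have : τ = 0 := by simpa [hw_def] using h
        simp [this]
      · simp [h]
    have huniv : {ω | 0.1 * q * c ^ 2 * (τ : ℝ) ^ 2 * ‖v‖ ^ 2 ≤
        ∑ i, σ' (∑ j, α ω i j * u j) ^ 2 * (∑ j, α ω i j * v j) ^ 2} = Set.univ := by
      refine Set.eq_univ_of_forall fun ω => ?_
      rw [Set.mem_ofPred_eq, mul_assoc _ ((τ : ℝ) ^ 2), hz, mul_zero]
      positivity
    rw [huniv, measure_univ]
    exact ENNReal.ofReal_le_one.2 (by linarith [exp_pos (-0.005 * q : ℝ)])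
  obtain ⟨hw, hv⟩ := not_or.1 hK
  have hwτ : (w : ℝ) = (τ : ℝ) ^ 2 := by simp [hw_def]
  have hw' : (0 : ℝ) < w := by positivity
  have hv' : 0 < ‖v‖ := norm_pos_iff.2 hv
  have hαm : AEMeasurable (fun ω => fun p : Fin q × Fin m => α ω p.1 p.2) P := by
    refine AEMeasurable.of_map_ne_zero ?_
    rw [hα]
    exact IsProbabilityMeasure.ne_zero _
  set f : (Fin m → ℝ) → ℝ := fun a => 2 / (c ^ 2 * w * ‖v‖ ^ 2) *
    (σ' (∑ j, a j * u j) ^ 2 * (∑ j, a j * v j) ^ 2) with hf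
  have hfm : Measurable f := by fun_prop
  have hbad := pi_sum_lt_le_exp (Measure.pi fun _ : Fin m => gaussianReal 0 w) hfm
    (fun a => by positivity) (integral_exp_neg_sq_mul_sq_le hw u v hv hσ'meas hc hσ') q
  set S : Set (Fin q × Fin m → ℝ) := {x | 0.2 * q ≤ ∑ i, f fun j => x (i, j)} with hS
  have hSm : MeasurableSet S := measurableSet_le (by fun_prop) (by fun_prop)
  have hevent : {ω | 0.1 * q * c ^ 2 * (τ : ℝ) ^ 2 * ‖v‖ ^ 2 ≤
      ∑ i, σ' (∑ j, α ω i j * u j) ^ 2 * (∑ j, α ω i j * v j) ^ 2}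
      = (fun ω => fun p : Fin q × Fin m => α ω p.1 p.2) ⁻¹' S := by
    ext ω
    simp only [hS, hf, Set.mem_preimage, Set.mem_ofPred_eq, ← Finset.mul_sum, ← hwτ]
    rw [div_mul_eq_mul_div, le_div_iff₀ (by positivity)]
    constructor <;> intro h <;> linarith
  rw [hevent, ← Measure.map_apply_of_aemeasurable hαm hSm, hα, ← map_uncurry_pi_pi,
    Measure.map_apply measurable_uncurry hSm]
  have hcompl : (Function.uncurry ⁻¹' S : Set (Fin q → Fin m → ℝ))ᶜ
      = {x | ∑ i, f (x i) < 0.2 * q} := by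
    ext x
    simp [hS]
  rw [← hcompl, probReal_compl_eq_one_sub (measurable_uncurry hSm)] at hbad
  rw [← ofReal_measureReal]
  exact ENNReal.ofReal_le_ofReal (by linarith)
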